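/- Fix N ≥ 1 and k > 1, set K_N := [−N,N]^d and let H := { μ ∈ M⁺(ℝ^d) : supp μ ⊆ K_N and μ(ℝ^d) ∈ [1/k, k] }. Let u : H → ℝ be bounded and continuous with respect to the weak topology. For n ≥ 1 define the empirical projection φⁿ(μ) := μ(ℝ^d)^{−n} ∫_{(ℝ^d)ⁿ} u( (μ(ℝ^d)/n) Σᵢ₌₁ⁿ δ_{xᵢ} ) dμ^{⊗n}(x₁,…,xₙ). Then for every μ ∈ H, φⁿ(μ) → u(μ) as n → ∞, and |φⁿ(μ)| ≤ sup_{ν∈H} |u(ν)| for all n and μ. -/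

import Mathlib

open MeasureTheory Set Filter Topology
open scoped NNReal ENNReal

noncomputable section

/-- `ℝ^d`. -/
abbrev Eu (d : ℕ) : Type := EuclideanSpace ℝ (Fin d)

/-- `M⁺(ℝ^d)`, the finite positive Borel measures on `ℝ^d`, with the weak topology. -/
abbrev Md (d : ℕ) : Type := MeasureTheory.FiniteMeasure (Eu d)

variable {d : ℕ}

/-- The segment `t μ' + (1 - t) μ` in the space of finite measures. -/
noncomputable def seg (μ μ' : Md d) (t : ℝ) : Md d :=
  t.toNNReal • μ' + (1 - t).toNNReal • μ

/-- `⟨μ, ψ⟩ = ∫ ψ dμ`. -/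
noncomputable def pairing (μ : Md d) (ψ : Eu d → ℝ) : ℝ :=
  ∫ x, ψ x ∂(μ : Measure (Eu d))

/-- `δu` is a linear functional derivative of `u : M⁺(ℝ^d) → ℝ`: it is bounded, jointly
continuous (weak topology on measures), and satisfies the fundamental identity. -/
def IsLFD (u : Md d → ℝ) (δu : Md d → Eu d → ℝ) : Prop :=
  (∃ C : ℝ, ∀ (μ : Md d) (x : Eu d), |δu μ x| ≤ C) ∧
  Continuous (fun p : Md d × Eu d => δu p.1 p.2) ∧
  ∀ μ μ' : Md d,
    u μ' - u μ =
      ∫ t in (0:ℝ)..1,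
        (pairing μ' (fun x => δu (seg μ μ' t) x) - pairing μ (fun x => δu (seg μ μ' t) x))

/-- The Dirac measure at `x` as a finite measure. -/
noncomputable def diracFM (x : Eu d) : Md d := ⟨Measure.dirac x, inferInstance⟩

/-- The compact rectangle `K_N = [−N,N]^d`. -/
def KN (d N : ℕ) : Set (Eu d) := {x : Eu d | ∀ i, |x i| ≤ (N : ℝ)}

/-- `H_N^k = {μ ∈ M⁺(ℝ^d) : supp μ ⊆ K_N, μ(ℝ^d) ∈ [1/k, k]}` (the support condition is
expressed as `μ(K_Nᶜ) = 0`, which is equivalent since `K_N` is closed). -/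
def HNk (d N : ℕ) (k : ℝ) : Set (Md d) :=
  {μ : Md d | (μ : Measure (Eu d)) (KN d N)ᶜ = 0 ∧
    1 / k ≤ (μ.mass : ℝ) ∧ (μ.mass : ℝ) ≤ k}

/-- The scaled empirical measure `(c/n) Σᵢ δ_{xᵢ}`. -/
noncomputable def empM {d : ℕ} (c : ℝ) (n : ℕ) (x : Fin n → Eu d) : Md d :=
  (c / (n : ℝ)).toNNReal • ∑ i : Fin n, diracFM (x i)

/-- The empirical projection
`φⁿ(μ) = μ(ℝ^d)^{−n} ∫ u((μ(ℝ^d)/n) Σᵢ δ_{xᵢ}) dμ^{⊗n}(x₁,…,xₙ)`. -/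
noncomputable def empProj {d : ℕ} (u : Md d → ℝ) (n : ℕ) (μ : Md d) : ℝ :=
  (((μ.mass : ℝ)) ^ n)⁻¹ *
    ∫ x : Fin n → Eu d, u (empM (μ.mass : ℝ) n x)
      ∂(Measure.pi fun _ : Fin n => (μ : Measure (Eu d)))

theorem integral_empM {c : ℝ} (hc : 0 ≤ c) (n : ℕ) (x : Fin n → Eu d)
    (f : BoundedContinuousFunction (Eu d) ℝ) :
    ∫ y, f y ∂(empM c n x : Measure (Eu d)) = c / n * ∑ i, f (x i) := by
  have hsum : ((∑ i, diracFM (x i) : Md d) : Measure (Eu d)) =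
      ∑ i, Measure.dirac (x i) := by
    rw [FiniteMeasure.toMeasure_sum]
    rfl
  rw [empM, FiniteMeasure.toMeasure_smul, integral_smul_nnreal_measure, hsum,
    integral_finsetSum_measure (fun i _ => f.integrable _)]
  simp [NNReal.smul_def, Real.coe_toNNReal _ (div_nonneg hc n.cast_nonneg)]

theorem continuous_empM {c : ℝ} (hc : 0 ≤ c) (n : ℕ) :
    Continuous (empM (d := d) c n) := by
  refine continuous_iff_continuousAt.2 fun x =>
    FiniteMeasure.tendsto_iff_forall_integral_tendsto.2 fun f => ?_
  simp_rw [integral_empM hc]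
  exact Continuous.tendsto (by fun_prop) x

theorem mass_empM {c : ℝ} (hc : 0 ≤ c) {n : ℕ} (hn : 1 ≤ n) (x : Fin n → Eu d) :
    ((empM c n x).mass : ℝ) = c := by
  have hn' : (n : ℝ) ≠ 0 := by positivity
  calc ((empM c n x).mass : ℝ) = (empM c n x : Measure (Eu d)).real univ := rfl
    _ = c / n * n := by simpa using integral_empM hc n x 1
    _ = c := div_mul_cancel₀ c hn'

theorem isClosed_KN (d N : ℕ) : IsClosed (KN d N) := by
  simp only [KN, ofPred_forall]
  exact isClosed_iInter fun i => isClosed_le (by fun_prop) (by fun_prop)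

theorem empM_mem_HNk {N : ℕ} {k c : ℝ} (hc : 0 ≤ c) (hkc : 1 / k ≤ c) (hck : c ≤ k) {n : ℕ}
    (hn : 1 ≤ n) {x : Fin n → Eu d} (hx : ∀ i, x i ∈ KN d N) : empM c n x ∈ HNk d N k := by
  refine ⟨?_, by rwa [mass_empM hc hn], by rwa [mass_empM hc hn]⟩
  have hK := (isClosed_KN d N).measurableSet.compl
  rw [empM, FiniteMeasure.toMeasure_smul, FiniteMeasure.toMeasure_sum]
  simp [diracFM, Measure.dirac_apply' _ hK, hx]

/-- The sets that contain the empirical measure of an i.i.d. sample with probability tending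
to one as the sample size grows. -/
def empFilter (P : Measure (Eu d)) (c : ℝ) : Filter (Md d) where
  sets := {U | Tendsto (fun n => (Measure.pi fun _ : Fin n => P) {x | empM c n x ∉ U})
    atTop (𝓝 0)}
  univ_sets := by simp
  sets_of_superset {U V} hU hUV :=
    tendsto_of_tendsto_of_tendsto_of_le_of_le tendsto_const_nhds hU (fun _ => zero_le)
      fun _ => measure_mono fun _ hx h => hx (hUV h)
  inter_sets {U V} hU hV := by
    have h := Tendsto.add hU hV
    rw [add_zero] at h
    refine tendsto_of_tendsto_of_tendsto_of_le_of_le tendsto_const_nhds h (fun _ => zero_le)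
      fun n => (measure_mono fun x hx => ?_).trans (measure_union_le _ _)
    simp only [mem_inter_iff, mem_ofPred_eq, mem_union] at hx ⊢
    tauto

theorem mem_empFilter {P : Measure (Eu d)} {c : ℝ} {U : Set (Md d)} :
    U ∈ empFilter P c ↔
      Tendsto (fun n => (Measure.pi fun _ : Fin n => P) {x | empM c n x ∉ U}) atTop (𝓝 0) :=
  Iff.rfl

theorem measure_pi_average_deviation_le (P : Measure (Eu d)) [IsProbabilityMeasure P]
    (f : BoundedContinuousFunction (Eu d) ℝ) {n : ℕ} (hn : 1 ≤ n) {ε : ℝ} (hε : 0 < ε) :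
    (Measure.pi fun _ : Fin n => P) {x | ε ≤ |(n : ℝ)⁻¹ * ∑ i, f (x i) - ∫ y, f y ∂P|} ≤
      ENNReal.ofReal (ProbabilityTheory.variance f P / ε ^ 2 * (n : ℝ)⁻¹) := by
  have hn' : (0 : ℝ) < n := by exact_mod_cast hn
  have hf : MemLp f 2 P := f.memLp_top.mono_exponent le_top
  have hi : ∀ i : Fin n, MemLp (fun x : Fin n → Eu d => f (x i)) 2
      (Measure.pi fun _ : Fin n => P) := fun i =>
    hf.comp_measurePreserving (measurePreserving_eval (fun _ : Fin n => P) i)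
  have hS : MemLp (∑ i : Fin n, fun x : Fin n → Eu d => f (x i)) 2
      (Measure.pi fun _ : Fin n => P) := memLp_finsetSum' _ fun i _ => hi i
  have hmean : ∫ x, (∑ i : Fin n, fun x : Fin n → Eu d => f (x i)) x
      ∂(Measure.pi fun _ : Fin n => P) = n * ∫ y, f y ∂P := by
    simp only [Finset.sum_apply]
    rw [integral_finsetSum _ fun i _ => (hi i).integrable (by norm_num)]
    simp [integral_comp_eval (μ := fun _ : Fin n => P) hf.aestronglyMeasurable]
  have hcheb := ProbabilityTheory.meas_ge_le_variance_div_sq hS (mul_pos hn' hε)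
  rw [ProbabilityTheory.variance_sum_pi (μ := fun _ : Fin n => P) (X := fun _ => f)
    fun _ => hf, hmean] at hcheb
  refine (measure_mono fun x hx => ?_).trans (hcheb.trans_eq ?_)
  · simp only [mem_ofPred_eq, Finset.sum_apply] at hx ⊢
    calc (n : ℝ) * ε ≤ n * |(n : ℝ)⁻¹ * ∑ i, f (x i) - ∫ y, f y ∂P| := by gcongr
      _ = |n * ((n : ℝ)⁻¹ * ∑ i, f (x i) - ∫ y, f y ∂P)| := by
        rw [abs_mul, abs_of_pos hn']
      _ = _ := by congr 1; field_simp
  · congr 1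
    simp only [Finset.sum_const, Finset.card_univ, Fintype.card_fin, nsmul_eq_mul]
    field_simp

/-- The weak law of large numbers for empirical measures. -/
theorem empFilter_le_nhds (P : Measure (Eu d)) [IsProbabilityMeasure P] {c : ℝ} (hc : 0 < c)
    {μ : Md d} (hμ : ∀ f : BoundedContinuousFunction (Eu d) ℝ,
      ∫ y, f y ∂(μ : Measure (Eu d)) = c * ∫ y, f y ∂P) :
    empFilter P c ≤ 𝓝 μ := by
  refine tendsto_id'.1 (FiniteMeasure.tendsto_iff_forall_integral_tendsto.2 fun f => ?_)
  refine Metric.tendsto_nhds.2 fun ε hε => mem_empFilter.2 ?_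
  have hlim : Tendsto (fun n : ℕ => ENNReal.ofReal
      (ProbabilityTheory.variance f P / (ε / c) ^ 2 * (n : ℝ)⁻¹)) atTop (𝓝 0) := by
    simpa using ENNReal.tendsto_ofReal
      (tendsto_inv_atTop_nhds_zero_nat (𝕜 := ℝ) |>.const_mul
        (ProbabilityTheory.variance f P / (ε / c) ^ 2))
  refine tendsto_of_tendsto_of_tendsto_of_le_of_le' tendsto_const_nhds hlim
    (Eventually.of_forall fun _ => zero_le) ?_
  filter_upwards [eventually_ge_atTop 1] with n hn
  refine (measure_mono fun x hx => ?_).trans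
    (measure_pi_average_deviation_le P f hn (div_pos hε hc))
  simp only [mem_ofPred_eq, id, not_lt, Real.dist_eq, integral_empM hc.le, hμ] at hx ⊢
  rw [div_le_iff₀ hc]
  calc ε ≤ _ := hx
    _ = |((n : ℝ)⁻¹ * ∑ i, f (x i) - ∫ y, f y ∂P) * c| := by congr 1; ring
    _ = _ := by rw [abs_mul, abs_of_pos hc]

theorem ae_pi_mem_KN {P : Measure (Eu d)} [IsProbabilityMeasure P] {N : ℕ}
    (hP : P (KN d N)ᶜ = 0) (n : ℕ) :
    ∀ᵐ x ∂(Measure.pi fun _ : Fin n => P), ∀ i, x i ∈ KN d N :=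
  eventually_all.2 fun _ =>
    (Measure.tendsto_eval_ae_ae (μ := fun _ : Fin n => P)).eventually (mem_ae_iff.2 hP)

theorem aestronglyMeasurable_comp_empM {N : ℕ} {k c : ℝ} {u : Md d → ℝ}
    (huc : ContinuousOn u (HNk d N k)) (hc : 0 ≤ c) (hkc : 1 / k ≤ c) (hck : c ≤ k)
    {P : Measure (Eu d)} [IsProbabilityMeasure P] (hP : P (KN d N)ᶜ = 0) {n : ℕ} (hn : 1 ≤ n) :
    AEStronglyMeasurable (fun x => u (empM c n x)) (Measure.pi fun _ : Fin n => P) := by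
  have hcont : ContinuousOn (fun x : Fin n → Eu d => u (empM c n x))
      {x | ∀ i, x i ∈ KN d N} :=
    huc.comp (continuous_empM hc n).continuousOn fun x hx => empM_mem_HNk hc hkc hck hn hx
  have hclosed : IsClosed {x : Fin n → Eu d | ∀ i, x i ∈ KN d N} := by
    simp only [ofPred_forall]
    exact isClosed_iInter fun i => (isClosed_KN d N).preimage (continuous_apply i)
  have h := hcont.aestronglyMeasurable (μ := Measure.pi fun _ : Fin n => P)
    hclosed.measurableSet
  rwa [Measure.restrict_eq_self_of_ae_mem
    (s := {x : Fin n → Eu d | ∀ i, x i ∈ KN d N}) (ae_pi_mem_KN hP n)] at h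

theorem empProj_eq_integral {μ : Md d} {P : Measure (Eu d)} [IsProbabilityMeasure P]
    (hμ : (μ : Measure (Eu d)) = μ.mass • P) (h0 : μ.mass ≠ 0) (u : Md d → ℝ) (n : ℕ) :
    empProj u n μ = ∫ x, u (empM μ.mass n x) ∂(Measure.pi fun _ : Fin n => P) := by
  have hpi : (Measure.pi fun _ : Fin n => (μ : Measure (Eu d))) =
      (μ.mass ^ n) • Measure.pi fun _ : Fin n => P := by
    refine Measure.pi_eq fun s _ => ?_
    have hs (i : Fin n) : (μ : Measure (Eu d)) (s i) = μ.mass * P (s i) :=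
      congrArg (fun ν : Measure (Eu d) => ν (s i)) hμ
    simp_rw [hs, Finset.prod_mul_distrib]
    simp [Measure.pi_pi, ENNReal.smul_def]
  rw [empProj, hpi, integral_smul_nnreal_measure, NNReal.smul_def, smul_eq_mul, NNReal.coe_pow,
    inv_mul_cancel_left₀ (pow_ne_zero _ (by exact_mod_cast h0))]

/-- If `g` is within `ε` of `a` outside a set `s`, and within `B` of `a` almost everywhere,
then its mean is within `ε + B * p s` of `a`. -/
theorem abs_integral_sub_le {Ω : Type*} [MeasurableSpace Ω] {p : Measure Ω}
    [IsProbabilityMeasure p] {g : Ω → ℝ} (hg : Integrable g p) {a B ε : ℝ}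
    (hε : 0 ≤ ε) (hgB : ∀ᵐ x ∂p, |g x - a| ≤ B) {s : Set Ω}
    (hs : ∀ x ∉ s, |g x - a| ≤ ε) :
    |∫ x, g x ∂p - a| ≤ ε + B * p.real s := by
  have hm := measurableSet_toMeasurable p s
  have hint : Integrable ((toMeasurable p s).indicator fun _ => B) p :=
    (integrable_const B).indicator hm
  calc |∫ x, g x ∂p - a| = |∫ x, (g x - a) ∂p| := by
        rw [integral_sub hg (integrable_const a)]; simp
    _ ≤ ∫ x, |g x - a| ∂p := abs_integral_le_integral_abs
    _ ≤ ∫ x, (ε + (toMeasurable p s).indicator (fun _ => B) x) ∂p := by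
        refine integral_mono_of_nonneg (Eventually.of_forall fun _ => abs_nonneg _)
          ((integrable_const ε).add hint) ?_
        filter_upwards [hgB] with x hx
        by_cases hxs : x ∈ toMeasurable p s
        · simpa [hxs] using by linarith
        · simpa [hxs] using hs x fun h => hxs (subset_toMeasurable p s h)
    _ = ε + B * p.real s := by
        rw [integral_add (integrable_const ε) hint, integral_indicator_const _ hm]
        simp [Measure.real, measure_toMeasurable, mul_comm]

theorem exists_normalization {μ : Md d} {N : ℕ} (hK : (μ : Measure (Eu d)) (KN d N)ᶜ = 0)
    (h0 : μ.mass ≠ 0) :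
    ∃ P : Measure (Eu d), IsProbabilityMeasure P ∧ (μ : Measure (Eu d)) = μ.mass • P ∧
      P (KN d N)ᶜ = 0 := by
  refine ⟨μ.normalize, inferInstance, ?_, ?_⟩
  · conv_lhs => rw [μ.self_eq_mass_smul_normalize]
    rfl
  · rw [μ.toMeasure_normalize_eq_of_nonzero (μ.mass_nonzero_iff.1 h0)]
    simp [hK]

/-- convergence of empirical projections. Fix `N ≥ 1`, `k > 1` and let
`H = H_N^k`. If `u` is bounded (by `C`) and weakly continuous on `H`, then for every
`μ ∈ H` the empirical projections `φⁿ(μ)` converge to `u(μ)`, and `|φⁿ(μ)| ≤ C` for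
every `n ≥ 1` and `μ ∈ H`. -/
theorem stmt15 (N : ℕ) (hN : 1 ≤ N) (k : ℝ) (hk : 1 < k)
    (u : Md d → ℝ) (C : ℝ)
    (hub : ∀ μ ∈ HNk d N k, |u μ| ≤ C)
    (huc : ContinuousOn u (HNk d N k)) :
    (∀ μ ∈ HNk d N k,
      Filter.Tendsto (fun n => empProj u n μ) Filter.atTop (nhds (u μ))) ∧
    (∀ n : ℕ, 1 ≤ n → ∀ μ ∈ HNk d N k, |empProj u n μ| ≤ C) := by
  have hmass : ∀ μ ∈ HNk d N k, 0 < (μ.mass : ℝ) := fun μ hμ =>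
    (one_div_pos.2 (by linarith)).trans_le hμ.2.1
  have hbound : ∀ (μ : Md d), μ ∈ HNk d N k → ∀ (P : Measure (Eu d)) [IsProbabilityMeasure P],
      P (KN d N)ᶜ = 0 → ∀ n : ℕ, 1 ≤ n → ∀ᵐ x ∂(Measure.pi fun _ : Fin n => P),
        empM (μ.mass : ℝ) n x ∈ HNk d N k := fun μ hμ P _ hP n hn => by
    filter_upwards [ae_pi_mem_KN hP n] with x hx
    exact empM_mem_HNk (hmass μ hμ).le hμ.2.1 hμ.2.2 hn hx
  constructor
  · intro μ hμ
    have h0 : μ.mass ≠ 0 := by exact_mod_cast (hmass μ hμ).ne'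
    obtain ⟨P, _, hμP, hP⟩ := exists_normalization hμ.1 h0
    have hC : 0 ≤ C := (abs_nonneg _).trans (hub μ hμ)
    have hle : empFilter P μ.mass ≤ 𝓝[HNk d N k] μ := by
      refine le_inf (empFilter_le_nhds P (hmass μ hμ) fun f => ?_)
        (le_principal_iff.2 (mem_empFilter.2 ?_))
      · conv_lhs => rw [hμP]
        rw [integral_smul_nnreal_measure, NNReal.smul_def, smul_eq_mul]
      · refine tendsto_const_nhds.congr' ?_
        filter_upwards [eventually_ge_atTop 1] with n hn
        exact (mem_ae_iff.1 (hbound μ hμ P hP n hn)).symm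
    refine Metric.tendsto_nhds.2 fun ε hε => ?_
    have hU := mem_empFilter.1
      (hle (Metric.tendsto_nhds.1 (huc μ hμ) (ε / 2) (half_pos hε)))
    have hlim := ((ENNReal.tendsto_toReal ENNReal.zero_ne_top).comp hU).const_mul (2 * C)
    rw [ENNReal.toReal_zero, mul_zero] at hlim
    filter_upwards [eventually_ge_atTop 1, hlim.eventually_lt_const (half_pos hε)] with n hn hlt
    have hb := hbound μ hμ P hP n hn
    rw [Real.dist_eq, empProj_eq_integral hμP h0]
    refine (abs_integral_sub_le (B := 2 * C) (ε := ε / 2) ?_ (by positivity) ?_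
      fun x hx => ?_).trans_lt ((add_lt_add_right hlt (ε / 2)).trans_eq (add_halves ε))
    · refine Integrable.of_bound (aestronglyMeasurable_comp_empM huc (hmass μ hμ).le hμ.2.1
        hμ.2.2 hP hn) C ?_
      filter_upwards [hb] with x hx using hub _ hx
    · filter_upwards [hb] with x hx
      exact (abs_sub _ _).trans (by linarith [hub _ hx, hub _ hμ])
    · exact (not_not.1 hx : dist _ _ < ε / 2).le
  · intro n hn μ hμ
    have h0 : μ.mass ≠ 0 := by exact_mod_cast (hmass μ hμ).ne'
    obtain ⟨P, _, hμP, hP⟩ := exists_normalization hμ.1 h0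
    rw [empProj_eq_integral hμP h0]
    have h := norm_integral_le_of_norm_le_const (μ := Measure.pi fun _ : Fin n => P)
      (f := fun x => u (empM μ.mass n x)) (C := C)
      ((hbound μ hμ P hP n hn).mono fun x hx => hub _ hx)
    simpa using h

end
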